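/- For every 0 < a < b < 1 and every α ∈ ℂ, the operator T(a, b, α) on ℓ²(ℤ,ℂ) ⊕ ℓ²(ℤ,ℂ) is homogeneous: its spectrum is contained in the closed unit disc, and for every θ ∈ ℝ and every c ∈ ℂ with |c| < 1, the operator 1 − conj(c)·T(a, b, α) is invertible and e^{iθ}(T(a, b, α) − c·1)(1 − conj(c)·T(a, b, α))⁻¹ is unitarily equivalent to T(a, b, α). -/

import Mathlib

noncomputable section

open ContinuousLinearMap

/-- The Hilbert space `ℓ²(ℤ, ℂ)`. -/
abbrev H : Type := lp (fun _ : ℤ => ℂ) 2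

/-- The standard orthonormal basis vectors of `ℓ²(ℤ, ℂ)`. -/
def e (n : ℤ) : H := lp.single 2 n 1

/-- The `2 × 2` upper-triangular block operator `[[T₁, S], [0, T₂]]` on the Hilbert space
direct sum `E ⊕ E = WithLp 2 (E × E)`. -/
def blockOp {E : Type*} [NormedAddCommGroup E] [NormedSpace ℂ E]
    (T₁ S T₂ : E →L[ℂ] E) : WithLp 2 (E × E) →L[ℂ] WithLp 2 (E × E) :=
  ((WithLp.prodContinuousLinearEquiv 2 ℂ E E).symm :
      E × E →L[ℂ] WithLp 2 (E × E)) ∘L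
    ((((T₁ ∘L fst ℂ E E) + (S ∘L snd ℂ E E)).prod (T₂ ∘L snd ℂ E E)) ∘L
      ((WithLp.prodContinuousLinearEquiv 2 ℂ E E) :
        WithLp 2 (E × E) →L[ℂ] E × E))

/-- Unitary equivalence of bounded operators on (possibly different) complex Hilbert spaces:
there is a unitary (= surjective linear isometry) `U` with `U A U⁻¹ = B`. -/
def UnitarilyEquiv {E F : Type*} [NormedAddCommGroup E] [NormedSpace ℂ E]
    [NormedAddCommGroup F] [NormedSpace ℂ F] (A : E →L[ℂ] E) (B : F →L[ℂ] F) : Prop :=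
  ∃ U : E ≃ₗᵢ[ℂ] F, ∀ x, U (A x) = B (U x)

/-- The Möbius transform `e^{iθ} (T - c·1)(1 - c̄·T)⁻¹` of an operator. -/
def mobius {E : Type*} [NormedAddCommGroup E] [NormedSpace ℂ E] [CompleteSpace E]
    (θ : ℝ) (c : ℂ) (T : E →L[ℂ] E) : E →L[ℂ] E :=
  Complex.exp (θ * Complex.I) •
    ((T - c • (1 : E →L[ℂ] E)) * Ring.inverse (1 - (starRingEnd ℂ c) • T))

/-- A bounded operator on a complex Hilbert space is homogeneous if its spectrum lies in the
closed unit disc and all its Möbius transforms are unitarily equivalent to it. -/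
def Homogeneous {E : Type*} [NormedAddCommGroup E] [NormedSpace ℂ E] [CompleteSpace E]
    (T : E →L[ℂ] E) : Prop :=
  spectrum ℂ T ⊆ Metric.closedBall 0 1 ∧
    ∀ (θ : ℝ) (c : ℂ), ‖c‖ < 1 →
      IsUnit (1 - (starRingEnd ℂ c) • T) ∧ UnitarilyEquiv (mobius θ c T) T

/-- A bounded operator is irreducible if the only closed subspaces invariant under both the
operator and its adjoint are `{0}` and the whole space. -/
def IrreducibleOp {E : Type*} [NormedAddCommGroup E] [InnerProductSpace ℂ E] [CompleteSpace E]
    (T : E →L[ℂ] E) : Prop :=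
  ∀ M : Submodule ℂ E, IsClosed (M : Set E) → (∀ x ∈ M, T x ∈ M) →
    (∀ x ∈ M, ContinuousLinearMap.adjoint T x ∈ M) → M = ⊥ ∨ M = ⊤

/-- Weight sequence of the shift `B_{λ, ia}`. -/
def wB (l a : ℝ) (n : ℤ) : ℂ :=
  ((n : ℂ) + (1 + (l : ℂ)) / 2 + Complex.I * (a : ℂ)) /
    ((n : ℂ) + (1 + (l : ℂ)) / 2 - Complex.I * (a : ℂ))

/-- Weight sequence of the shift `T(a, b)`. -/
def wT (a b : ℝ) (n : ℤ) : ℂ := (Real.sqrt (((n : ℝ) + a) / ((n : ℝ) + b)) : ℂ)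

/-- Weight sequence of the shift `S[λ]`. -/
def wS (l : ℝ) (n : ℤ) : ℂ := ((l : ℂ) + 2 * (n : ℂ) + 1)⁻¹


open scoped InnerProductSpace

lemma inner_e_left (n : ℤ) (x : H) : ⟪e n, x⟫_ℂ = x n := by
  simp [e, lp.inner_single_left]

lemma e_apply (n m : ℤ) : e n m = if m = n then 1 else 0 := by
  simp [e, lp.single_apply, Pi.single_apply]

lemma norm_e (n : ℤ) : ‖e n‖ = 1 := by
  simp [e, lp.norm_single]

/-- Bounded operators on `ℓ²(ℤ)` that agree on the standard basis are equal. -/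
lemma ext_e {F : Type*} [NormedAddCommGroup F] [NormedSpace ℂ F] {A B : H →L[ℂ] F}
    (h : ∀ n, A (e n) = B (e n)) : A = B := by
  refine lp.ext_continuousLinearMap (by norm_num) fun n => ?_
  ext
  simpa [e] using h n

lemma adjoint_shift_apply {T : H →L[ℂ] H} {w : ℤ → ℂ} {m : ℤ}
    (hT : ∀ n, T (e n) = w n • e (n + m)) (x : H) (n : ℤ) :
    adjoint T x n = starRingEnd ℂ (w n) * x (n + m) := by
  rw [← inner_e_left, adjoint_inner_right, hT, inner_smul_left, inner_e_left]

lemma adjoint_shift_e {T : H →L[ℂ] H} {w : ℤ → ℂ} {m : ℤ}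
    (hT : ∀ n, T (e n) = w n • e (n + m)) (n : ℤ) :
    adjoint T (e (n + m)) = starRingEnd ℂ (w n) • e n := by
  ext k
  rw [adjoint_shift_apply hT]
  by_cases hk : k = n
  · subst hk; simp [e_apply]
  · simp [e_apply, hk]

lemma shift_apply {T : H →L[ℂ] H} {w : ℤ → ℂ} {m : ℤ}
    (hT : ∀ n, T (e n) = w n • e (n + m)) (x : H) (n : ℤ) :
    T x (n + m) = w n * x n := by
  rw [← inner_e_left, ← adjoint_inner_left, adjoint_shift_e hT, inner_smul_left, inner_e_left]
  simp

lemma norm_shift_le {T : H →L[ℂ] H} {w : ℤ → ℂ} {m : ℤ}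
    (hT : ∀ n, T (e n) = w n • e (n + m)) {C : ℝ} (hC : ∀ n, ‖w n‖ ≤ C) : ‖T‖ ≤ C := by
  have hC0 : 0 ≤ C := (norm_nonneg _).trans (hC 0)
  refine T.opNorm_le_bound hC0 fun x => ?_
  have h1 : HasSum (fun n => ‖T x n‖ ^ 2) (‖T x‖ ^ 2) := by
    simpa using lp.hasSum_norm (p := 2) (by norm_num) (T x)
  have h2 : HasSum (fun n => ‖x n‖ ^ 2) (‖x‖ ^ 2) := by
    simpa using lp.hasSum_norm (p := 2) (by norm_num) x
  have h3 : HasSum (fun n => ‖T x (n + m)‖ ^ 2) (‖T x‖ ^ 2) :=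
    (Equiv.addRight m).hasSum_iff.mpr h1
  have h4 := hasSum_le (fun n => ?_) h3 (h2.mul_left (C ^ 2))
  · rw [← mul_pow] at h4
    exact le_of_sq_le_sq h4 (by positivity)
  · rw [shift_apply hT, norm_mul, mul_pow]
    gcongr
    exact hC n

lemma shift_pow_e {T : H →L[ℂ] H} {w : ℤ → ℂ}
    (hT : ∀ n, T (e n) = w n • e (n + 1)) (m : ℕ) (n : ℤ) :
    (T ^ m) (e n) = (∏ j ∈ Finset.range m, w (n + j)) • e (n + m) := by
  induction m with
  | zero => simp
  | succ m ih =>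
    rw [pow_succ', mul_apply_eq_comp, ih, map_smul, hT, smul_smul,
      Finset.prod_range_succ]
    push_cast
    rw [add_assoc]

/-- A bilateral shift whose weights have limits of modulus at most one at both ends has spectral
radius at most one. -/
lemma isUnit_one_sub_smul_shift {T : H →L[ℂ] H} {w : ℤ → ℂ}
    (hT : ∀ n, T (e n) = w n • e (n + 1)) {M : ℝ} (hM : ∀ n, ‖w n‖ ≤ M)
    (hw : ∀ ε > 0, ∃ N : ℕ, ∀ n : ℤ, N ≤ |n| → ‖w n‖ ≤ 1 + ε) {c : ℂ} (hc : ‖c‖ < 1) :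
    IsUnit (1 - c • T) := by
  obtain ⟨ε, hε, hcε⟩ : ∃ ε > 0, ‖c‖ * (1 + ε) < 1 := by
    refine ⟨(1 - ‖c‖) / 2, by linarith, ?_⟩
    nlinarith [norm_nonneg c]
  obtain ⟨N, hN⟩ := hw ε hε
  set K : ℝ := max M 1 with hK
  have hK1 : 1 ≤ K := le_max_right _ _
  set S : Finset ℤ := Finset.Icc (-N : ℤ) N with hS
  have hbound : ∀ m : ℕ, ‖(c • T) ^ m‖ ≤ K ^ S.card * (‖c‖ * (1 + ε)) ^ m := by
    intro m
    rw [smul_pow, norm_smul, norm_pow, mul_pow, mul_left_comm]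
    gcongr
    refine norm_shift_le (shift_pow_e hT m) fun n => ?_
    rw [norm_prod]
    have hle : ∀ j ∈ Finset.range m,
        ‖w (n + j)‖ ≤ (if n + (j : ℤ) ∈ S then K else 1) * (1 + ε) := by
      intro j _
      split_ifs with hj
      · calc ‖w (n + j)‖ ≤ K := (hM _).trans (le_max_left _ _)
          _ ≤ K * (1 + ε) := by nlinarith
      · rw [one_mul]
        apply hN
        by_contra hlt
        push Not at hlt
        exact hj (Finset.mem_Icc.2 (abs_le.1 hlt.le))
    refine (Finset.prod_le_prod (fun _ _ => norm_nonneg _) hle).trans ?_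
    rw [Finset.prod_mul_distrib, Finset.prod_const, Finset.card_range]
    gcongr
    rw [Finset.prod_ite, Finset.prod_const, Finset.prod_const_one, mul_one]
    refine pow_le_pow_right₀ hK1 ?_
    refine Finset.card_le_card_of_injOn (fun j : ℕ => n + (j : ℤ)) (fun j hj => ?_) ?_
    · exact (Finset.mem_filter.1 hj).2
    · intro i _ j _ hij
      simpa using hij
  have hsum : Summable fun m : ℕ => (c • T) ^ m :=
    Summable.of_norm_bounded
      ((summable_geometric_of_lt_one (by positivity) hcε).mul_left _) hbound
  exact ⟨⟨_, _, hsum.one_sub_mul_tsum_pow, hsum.tsum_pow_mul_one_sub⟩, rfl⟩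

section Block

lemma withLp_prod_ext {E : Type*} {x y : WithLp 2 (E × E)} (h₁ : x.fst = y.fst)
    (h₂ : x.snd = y.snd) :
    x = y :=
  WithLp.ofLp_injective 2 (Prod.ext h₁ h₂)

variable {E : Type*} [NormedAddCommGroup E] [NormedSpace ℂ E]

lemma blockOp_apply_fst (X S Y : E →L[ℂ] E) (x : WithLp 2 (E × E)) :
    (blockOp X S Y x).fst = X x.fst + S x.snd := rfl

lemma blockOp_apply_snd (X S Y : E →L[ℂ] E) (x : WithLp 2 (E × E)) :
    (blockOp X S Y x).snd = Y x.snd := rfl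

lemma blockOp_one (α : ℂ) :
    blockOp (1 : E →L[ℂ] E) (α • (1 - 1)) 1 = 1 := by
  ext x : 1
  apply withLp_prod_ext <;> simp [blockOp_apply_fst, blockOp_apply_snd]

lemma blockOp_mul (α : ℂ) (X Y X' Y' : E →L[ℂ] E) :
    blockOp X (α • (X - Y)) Y * blockOp X' (α • (X' - Y')) Y' =
      blockOp (X * X') (α • (X * X' - Y * Y')) (Y * Y') := by
  ext x : 1
  apply withLp_prod_ext <;> simp [blockOp_apply_fst, blockOp_apply_snd, smul_sub]
  abel

lemma blockOp_smul (α c : ℂ) (X Y : E →L[ℂ] E) :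
    c • blockOp X (α • (X - Y)) Y = blockOp (c • X) (α • (c • X - c • Y)) (c • Y) := by
  ext x : 1
  apply withLp_prod_ext <;>
    simp [blockOp_apply_fst, blockOp_apply_snd, smul_sub, smul_comm α c]

lemma blockOp_sub (α : ℂ) (X Y X' Y' : E →L[ℂ] E) :
    blockOp X (α • (X - Y)) Y - blockOp X' (α • (X' - Y')) Y' =
      blockOp (X - X') (α • ((X - X') - (Y - Y'))) (Y - Y') := by
  ext x : 1
  apply withLp_prod_ext <;> simp [blockOp_apply_fst, blockOp_apply_snd, smul_sub]
  abel

lemma Ring.inverse_eq_of_mul_eq_one {R : Type*} [Ring R] {x y : R} (h : x * y = 1)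
    (h' : y * x = 1) : Ring.inverse x = y :=
  Ring.inverse_unit ⟨x, y, h, h'⟩

lemma isUnit_blockOp {α : ℂ} {X Y : E →L[ℂ] E} (hX : IsUnit X) (hY : IsUnit Y) :
    IsUnit (blockOp X (α • (X - Y)) Y) ∧
      Ring.inverse (blockOp X (α • (X - Y)) Y) =
        blockOp (Ring.inverse X) (α • (Ring.inverse X - Ring.inverse Y)) (Ring.inverse Y) := by
  have h1 : blockOp X (α • (X - Y)) Y *
      blockOp (Ring.inverse X) (α • (Ring.inverse X - Ring.inverse Y)) (Ring.inverse Y) = 1 := by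
    rw [blockOp_mul, Ring.mul_inverse_cancel _ hX, Ring.mul_inverse_cancel _ hY, blockOp_one]
  have h2 : blockOp (Ring.inverse X) (α • (Ring.inverse X - Ring.inverse Y)) (Ring.inverse Y) *
      blockOp X (α • (X - Y)) Y = 1 := by
    rw [blockOp_mul, Ring.inverse_mul_cancel _ hX, Ring.inverse_mul_cancel _ hY, blockOp_one]
  exact ⟨⟨⟨_, _, h1, h2⟩, rfl⟩, Ring.inverse_eq_of_mul_eq_one h1 h2⟩

lemma one_sub_smul_blockOp (α c : ℂ) (X Y : E →L[ℂ] E) :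
    1 - c • blockOp X (α • (X - Y)) Y =
      blockOp (1 - c • X) (α • ((1 - c • X) - (1 - c • Y))) (1 - c • Y) := by
  rw [blockOp_smul, ← blockOp_one α, blockOp_sub]

/-- The block operator `[[T₁, α(T₁ - T₂)], [0, T₂]]` is homogeneous as soon as the Möbius
transforms of `T₁` and `T₂` are simultaneously unitarily equivalent to `T₁` and `T₂`. -/
lemma homogeneous_blockOp [CompleteSpace E] {T₁ T₂ : E →L[ℂ] E} (α : ℂ)
    (h₁ : ∀ c : ℂ, ‖c‖ < 1 → IsUnit (1 - c • T₁)) (h₂ : ∀ c : ℂ, ‖c‖ < 1 → IsUnit (1 - c • T₂))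
    (hU : ∀ (θ : ℝ) (c : ℂ), ‖c‖ < 1 → ∃ U : E ≃ₗᵢ[ℂ] E,
      (∀ x, U (mobius θ c T₁ x) = T₁ (U x)) ∧ ∀ x, U (mobius θ c T₂ x) = T₂ (U x)) :
    Homogeneous (blockOp T₁ (α • (T₁ - T₂)) T₂) := by
  have hunit : ∀ c : ℂ, ‖c‖ < 1 → IsUnit (1 - c • blockOp T₁ (α • (T₁ - T₂)) T₂) := by
    intro c hc
    rw [one_sub_smul_blockOp]
    exact (isUnit_blockOp (h₁ c hc) (h₂ c hc)).1
  refine ⟨fun z hz => ?_, fun θ c hc => ⟨hunit _ (by simpa using hc), ?_⟩⟩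
  · rw [mem_closedBall_zero_iff]
    by_contra! hlt
    have hz0 : z ≠ 0 := by
      rintro rfl
      simp at hlt
      linarith
    refine hz ?_
    have hz1 : ‖z⁻¹‖ < 1 := by
      rw [norm_inv]
      exact inv_lt_one_of_one_lt₀ hlt
    have hmul : algebraMap ℂ _ z - blockOp T₁ (α • (T₁ - T₂)) T₂ =
        algebraMap ℂ _ z * (1 - z⁻¹ • blockOp T₁ (α • (T₁ - T₂)) T₂) := by
      rw [mul_sub, mul_one, Algebra.algebraMap_eq_smul_one, smul_one_mul, smul_smul,
        mul_inv_cancel₀ hz0, one_smul]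
    rw [spectrum.mem_resolventSet_iff, hmul]
    exact ((isUnit_iff_ne_zero.2 hz0).map (algebraMap ℂ _)).mul (hunit _ hz1)
  · have hc' : ‖starRingEnd ℂ c‖ < 1 := by simpa using hc
    obtain ⟨U, hU₁, hU₂⟩ := hU θ c hc
    have hmob : mobius θ c (blockOp T₁ (α • (T₁ - T₂)) T₂) =
        blockOp (mobius θ c T₁) (α • (mobius θ c T₁ - mobius θ c T₂)) (mobius θ c T₂) := by
      unfold mobius
      rw [one_sub_smul_blockOp, (isUnit_blockOp (h₁ _ hc') (h₂ _ hc')).2, ← blockOp_one α,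
        blockOp_smul, blockOp_sub, blockOp_mul, blockOp_smul]
    refine ⟨U.withLpProdCongr 2 U, fun x => ?_⟩
    rw [hmob]
    apply withLp_prod_ext <;>
      simp [blockOp_apply_fst, blockOp_apply_snd, hU₁, hU₂]

end Block

lemma adjoint_shift_shift_apply {T : H →L[ℂ] H} {r : ℤ → ℝ}
    (hT : ∀ n, T (e n) = (r n : ℂ) • e (n + 1)) (x : H) (n : ℤ) :
    adjoint T (T x) n = ((r n ^ 2 : ℝ) : ℂ) * x n := by
  rw [adjoint_shift_apply hT, shift_apply hT, Complex.conj_ofReal]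
  push_cast
  ring

/-- Schur's lemma for a bilateral shift with distinct positive weights. -/
lemma eq_smul_one_of_commute_shift {T X : H →L[ℂ] H} {r : ℤ → ℝ} (hr : ∀ n, 0 < r n)
    (hinj : Function.Injective r) (hT : ∀ n, T (e n) = (r n : ℂ) • e (n + 1))
    (h : Commute X T) (h' : Commute X (adjoint T)) : ∃ p : ℂ, X = p • 1 := by
  have h1 : ∀ n, X (e n) = X (e n) n • e n := by
    intro n
    ext k
    by_cases hk : k = n
    · subst hk; simp [e_apply]
    · have hcomm := congrArg (fun A : H →L[ℂ] H => A (e n) k) (h'.mul_right h).eq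
      have he : adjoint T (T (e n)) = ((r n ^ 2 : ℝ) : ℂ) • e n := by
        rw [hT, map_smul, adjoint_shift_e hT, Complex.conj_ofReal, smul_smul]
        push_cast
        rw [sq]
      simp only [mul_apply_eq_comp, he, map_smul, adjoint_shift_shift_apply hT] at hcomm
      simp only [lp.coeFn_smul, Pi.smul_apply, smul_eq_mul] at hcomm ⊢
      have hne : ((r n ^ 2 : ℝ) : ℂ) - ((r k ^ 2 : ℝ) : ℂ) ≠ 0 := by
        rw [sub_ne_zero, Ne, Complex.ofReal_inj, sq_eq_sq₀ (hr n).le (hr k).le]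
        exact fun hnk => hk (hinj hnk).symm
      have : (((r n ^ 2 : ℝ) : ℂ) - ((r k ^ 2 : ℝ) : ℂ)) * X (e n) k = 0 := by
        linear_combination hcomm
      simp [(mul_eq_zero.1 this).resolve_left hne, e_apply, hk]
  have h2 : ∀ n, X (e (n + 1)) (n + 1) = X (e n) n := by
    intro n
    have hcomm := congrArg (fun A : H →L[ℂ] H => A (e n) (n + 1)) h.eq
    simp only [mul_apply_eq_comp, hT, map_smul] at hcomm
    rw [shift_apply hT, lp.coeFn_smul, Pi.smul_apply, smul_eq_mul] at hcomm
    exact mul_left_cancel₀ (Complex.ofReal_ne_zero.2 (hr n).ne') hcomm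
  have h3 : ∀ n, X (e n) n = X (e 0) 0 := by
    intro n
    induction n using Int.induction_on with
    | zero => rfl
    | succ i ih => rw [h2, ih]
    | pred i ih => rw [← ih, ← h2, sub_add_cancel]
  refine ⟨X (e 0) 0, ext_e fun n => ?_⟩
  rw [h1, h3]
  simp

/-- A sequence of nonzero eigenvectors of `A* A` moved forward by `A` yields an isometry
intertwining `A` with a bilateral shift, and their adjoints. -/
lemma exists_intertwining_isometry {T A : H →L[ℂ] H} {r : ℤ → ℝ} (hr : ∀ n, 0 < r n)
    (hinj : Function.Injective r) (hT : ∀ n, T (e n) = (r n : ℂ) • e (n + 1))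
    {f : ℤ → H} (hf : ∀ n, f n ≠ 0) (hA : ∀ n, A (f n) = f (n + 1))
    (hAA : ∀ n, adjoint A (A (f n)) = ((r n ^ 2 : ℝ) : ℂ) • f n) :
    ∃ W : H →ₗᵢ[ℂ] H, (∀ x, A (W x) = W (T x)) ∧
      ∀ x, adjoint A (W x) = W (adjoint T x) := by
  have hnorm : ∀ n, ‖f (n + 1)‖ = r n * ‖f n‖ := by
    intro n
    have h : (‖f (n + 1)‖ : ℂ) ^ 2 = (r n * ‖f n‖ : ℂ) ^ 2 := by
      rw [← hA, mul_pow]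
      have h1 := inner_self_eq_norm_sq_to_K (𝕜 := ℂ) (A (f n))
      have h2 := inner_self_eq_norm_sq_to_K (𝕜 := ℂ) (f n)
      rw [← adjoint_inner_right, hAA, inner_smul_right, h2] at h1
      simpa using h1.symm
    have h' : ‖f (n + 1)‖ ^ 2 = (r n * ‖f n‖) ^ 2 := by exact_mod_cast h
    exact (sq_eq_sq₀ (norm_nonneg _) (mul_nonneg (hr n).le (norm_nonneg _))).1 h'
  have horth : Orthonormal ℂ fun n => ((‖f n‖⁻¹ : ℝ) : ℂ) • f n := by
    refine ⟨fun n => ?_, fun n m hnm => ?_⟩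
    · have := norm_ne_zero_iff.2 (hf n)
      simp [norm_smul, this]
    · have h1 : ⟪adjoint A (A (f n)), f m⟫_ℂ = ⟪f n, adjoint A (A (f m))⟫_ℂ := by
        rw [adjoint_inner_left, adjoint_inner_right]
      rw [hAA, hAA, inner_smul_left, inner_smul_right, Complex.conj_ofReal] at h1
      have hne : ((r n ^ 2 : ℝ) : ℂ) - ((r m ^ 2 : ℝ) : ℂ) ≠ 0 := by
        rw [sub_ne_zero, Ne, Complex.ofReal_inj, sq_eq_sq₀ (hr n).le (hr m).le]
        exact fun h => hnm (hinj h)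
      have h2 : (((r n ^ 2 : ℝ) : ℂ) - ((r m ^ 2 : ℝ) : ℂ)) * ⟪f n, f m⟫_ℂ = 0 := by
        linear_combination h1
      simp only [inner_smul_left, inner_smul_right, (mul_eq_zero.1 h2).resolve_left hne, mul_zero]
  set W : H →ₗᵢ[ℂ] H := horth.orthogonalFamily.linearIsometry with hW
  have hWe : ∀ n, W (e n) = ((‖f n‖⁻¹ : ℝ) : ℂ) • f n := by
    intro n
    rw [hW, e, OrthogonalFamily.linearIsometry_apply_single]
    simp
  refine ⟨W, fun x => ?_, fun x => ?_⟩
  · have : A ∘L W.toContinuousLinearMap = W.toContinuousLinearMap ∘L T := by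
      refine ext_e fun n => ?_
      have h0 : (‖f n‖ : ℂ) ≠ 0 := Complex.ofReal_ne_zero.2 (norm_ne_zero_iff.2 (hf n))
      have hr0 : (r n : ℂ) ≠ 0 := Complex.ofReal_ne_zero.2 (hr n).ne'
      simp only [ContinuousLinearMap.coe_comp, Function.comp_apply,
        LinearIsometry.coe_toContinuousLinearMap, hWe, hT,
        map_smul, hA, smul_smul, hnorm]
      congr 1
      push_cast
      field_simp
    exact congrArg (fun B : H →L[ℂ] H => B x) this
  · have : adjoint A ∘L W.toContinuousLinearMap = W.toContinuousLinearMap ∘L adjoint T := by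
      refine ext_e fun n => ?_
      obtain ⟨n, rfl⟩ : ∃ k, n = k + 1 := ⟨n - 1, by ring⟩
      have h0 : (‖f n‖ : ℂ) ≠ 0 := Complex.ofReal_ne_zero.2 (norm_ne_zero_iff.2 (hf n))
      have hr0 : (r n : ℂ) ≠ 0 := Complex.ofReal_ne_zero.2 (hr n).ne'
      have hAf : adjoint A (f (n + 1)) = ((r n ^ 2 : ℝ) : ℂ) • f n := by rw [← hA, hAA]
      simp only [ContinuousLinearMap.coe_comp, Function.comp_apply,
        LinearIsometry.coe_toContinuousLinearMap, hWe,
        adjoint_shift_e hT, map_smul, Complex.conj_ofReal, hAf, smul_smul, hnorm]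
      congr 1
      push_cast
      field_simp
    exact congrArg (fun B : H →L[ℂ] H => B x) this

/-- The adjoint of the Möbius transform of `T₁` inverts the one of `T₂` if `T₂` inverts `T₁*`. -/
lemma adjoint_mobius_mul_mobius {T₁ T₂ : H →L[ℂ] H} (h : adjoint T₁ * T₂ = 1)
    (h' : T₂ * adjoint T₁ = 1) {θ : ℝ} {c : ℂ}
    (h₁ : IsUnit (1 - (starRingEnd ℂ c) • T₁))
    (h₂ : IsUnit (1 - (starRingEnd ℂ c) • T₂)) :
    mobius θ c T₂ * adjoint (mobius θ c T₁) = 1 := by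
  have hexp : Complex.exp (θ * Complex.I) * starRingEnd ℂ (Complex.exp (θ * Complex.I)) = 1 := by
    rw [← Complex.exp_conj, ← Complex.exp_add]
    simp
  set L₁ := 1 - (starRingEnd ℂ c) • T₁ with hL₁
  set L₂ := 1 - (starRingEnd ℂ c) • T₂ with hL₂
  have e1 : T₂ - c • 1 = T₂ * star L₁ := by
    simp only [hL₁, star_sub, star_one, star_smul, mul_sub, mul_one, mul_smul_comm,
      star_eq_adjoint, h']
    simp
  have e2 : star (T₁ - c • 1) = L₂ * adjoint T₁ := by
    simp only [hL₂, star_sub, star_one, star_smul, sub_mul, one_mul, smul_mul_assoc,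
      star_eq_adjoint, h']
    simp
  have e3 : star (Ring.inverse L₁) * star L₁ = 1 := by
    rw [← star_mul, Ring.mul_inverse_cancel _ h₁, star_one]
  have e3' : star L₁ * star (Ring.inverse L₁) = 1 := by
    rw [← star_mul, Ring.inverse_mul_cancel _ h₁, star_one]
  unfold mobius
  rw [← star_eq_adjoint, star_smul, star_mul, smul_mul_smul_comm, ← hL₁, ← hL₂, e1, e2,
    RCLike.star_def, hexp, one_smul]
  have hcomm' : Commute (star L₁) (Ring.inverse L₂) := by
    rw [← h₂.unit_spec, Ring.inverse_unit]
    refine Commute.units_inv_right ?_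
    rw [h₂.unit_spec, hL₁, hL₂, star_sub, star_one, star_smul, star_eq_adjoint]
    have : Commute (adjoint T₁) T₂ := h.trans h'.symm
    exact (Commute.one_left _).sub_left
      (((Commute.one_right _).sub_right (this.smul_right _)).smul_left _)
  have hswap : Ring.inverse L₂ * star (Ring.inverse L₁) =
      star (Ring.inverse L₁) * Ring.inverse L₂ := by
    calc Ring.inverse L₂ * star (Ring.inverse L₁)
        = star (Ring.inverse L₁) * (star L₁ * Ring.inverse L₂) * star (Ring.inverse L₁) := by
          rw [← mul_assoc (star (Ring.inverse L₁)), e3, one_mul]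
      _ = star (Ring.inverse L₁) * Ring.inverse L₂ := by
          rw [hcomm'.eq, mul_assoc, mul_assoc, e3', mul_one]
  calc T₂ * star L₁ * Ring.inverse L₂ * (star (Ring.inverse L₁) * (L₂ * adjoint T₁))
      = T₂ * star L₁ * (Ring.inverse L₂ * star (Ring.inverse L₁)) * (L₂ * adjoint T₁) := by
        simp only [mul_assoc]
    _ = T₂ * (star L₁ * star (Ring.inverse L₁)) * (Ring.inverse L₂ * L₂) * adjoint T₁ := by
        rw [hswap]
        simp only [mul_assoc]
    _ = 1 := by
        rwa [e3', Ring.inverse_mul_cancel _ h₂, mul_one, mul_one]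

/-- An isometry intertwining the Möbius transform of a bilateral shift (and its adjoint) with the
shift (and its adjoint) is unitary. -/
lemma surjective_of_intertwining {T : H →L[ℂ] H} {r : ℤ → ℝ} (hr : ∀ n, 0 < r n)
    (hinj : Function.Injective r) (hT : ∀ n, T (e n) = (r n : ℂ) • e (n + 1)) {θ : ℝ} {c : ℂ}
    (hc : ‖c‖ < 1) (hunit : IsUnit (1 - (starRingEnd ℂ c) • T)) {W : H →ₗᵢ[ℂ] H}
    (h : ∀ x, mobius θ c T (W x) = W (T x))
    (h' : ∀ x, adjoint (mobius θ c T) (W x) = W (adjoint T x)) : Function.Surjective W := by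
  set A := mobius θ c T with hA
  set V : H →L[ℂ] H := W.toContinuousLinearMap with hV
  set L := 1 - (starRingEnd ℂ c) • T with hL
  have hAV : A * V = V * T := ext h
  have hAV' : star A * V = V * star T := ext h'
  have hVA : star V * A = T * star V := by
    simpa using congrArg star hAV'
  set X := V * star V with hX
  have hXA : Commute X A := by
    change V * star V * A = A * (V * star V)
    rw [mul_assoc, hVA, ← mul_assoc, ← mul_assoc, hAV]
  have hexp : Complex.exp (-(θ * Complex.I)) * Complex.exp (θ * Complex.I) = 1 := by
    rw [← Complex.exp_add]
    simp
  have hXA₀ : Commute X ((T - c • 1) * Ring.inverse L) := by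
    have := hXA.smul_right (Complex.exp (-(θ * Complex.I)))
    rwa [hA, mobius, smul_smul, hexp, one_smul] at this
  have hs : (1 - starRingEnd ℂ c * c) ≠ 0 := by
    rw [mul_comm, Complex.mul_conj, Complex.normSq_eq_norm_sq, sub_ne_zero]
    norm_cast
    nlinarith [norm_nonneg c]
  have hinv : Ring.inverse L = (1 - starRingEnd ℂ c * c)⁻¹ •
      (1 + starRingEnd ℂ c • ((T - c • 1) * Ring.inverse L)) := by
    have h1 : L + starRingEnd ℂ c • (T - c • 1) = (1 - starRingEnd ℂ c * c) • 1 := by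
      rw [hL, smul_sub, smul_smul, sub_smul, one_smul]
      abel
    have h2 : 1 + starRingEnd ℂ c • ((T - c • 1) * Ring.inverse L) =
        (1 - starRingEnd ℂ c * c) • Ring.inverse L := by
      rw [← smul_one_mul _ (Ring.inverse L), ← h1, add_mul, Ring.mul_inverse_cancel _ hunit,
        smul_mul_assoc]
    rw [h2, smul_smul, inv_mul_cancel₀ hs, one_smul]
  have hXinv : Commute X (Ring.inverse L) := by
    rw [hinv]
    exact ((Commute.one_right _).add_right (hXA₀.smul_right _)).smul_right _
  have hXL : Commute X L := by
    rw [← hunit.unit_spec, Ring.inverse_unit] at hXinv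
    rw [← hunit.unit_spec]
    exact Commute.units_inv_right_iff.1 hXinv
  have hXT : Commute X T := by
    have h1 := hXA₀.mul_right hXL
    rw [mul_assoc, Ring.inverse_mul_cancel _ hunit, mul_one] at h1
    have h2 := h1.add_right ((Commute.one_right X).smul_right c)
    rwa [sub_add_cancel] at h2
  have hXT' : Commute X (adjoint T) := by
    have h1 := hXT.star_star
    rwa [hX, star_mul, star_star] at h1
  obtain ⟨p, hp⟩ := eq_smul_one_of_commute_shift hr hinj hT hXT hXT'
  have hVV : star V * V = 1 := by
    refine ext fun x => ext_inner_left ℂ fun y => ?_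
    rw [mul_apply_eq_comp, star_eq_adjoint, adjoint_inner_right]
    exact W.inner_map_map y x
  have hpV : V = p • V := by
    calc V = X * V := by rw [hX, mul_assoc, hVV, mul_one]
      _ = p • V := by rw [hp, smul_one_mul]
  intro y
  have hp1 : p = 1 := by
    have h2 : (1 - p) • W (e 0) = 0 := by
      rw [sub_smul, one_smul, sub_eq_zero]
      exact congrArg (fun B : H →L[ℂ] H => B (e 0)) hpV
    have h3 : W (e 0) ≠ 0 := by
      rw [← norm_ne_zero_iff, W.norm_map, norm_e]
      exact one_ne_zero
    exact (sub_eq_zero.1 ((smul_eq_zero.1 h2).resolve_right h3)).symm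
  refine ⟨star V y, ?_⟩
  rw [hp1, one_smul] at hp
  exact congrArg (fun B : H →L[ℂ] H => B y) hp

/-- If the Möbius transform `A` of a bilateral shift `T₁` has nonzero eigenvectors of `A* A` moved
forward by `A`, the transforms of `T₁` and of `T₂ = (T₁*)⁻¹` are simultaneously unitarily
equivalent to `T₁` and `T₂`. -/
lemma exists_unitary_mobius {T₁ T₂ : H →L[ℂ] H} {r : ℤ → ℝ} (hr : ∀ n, 0 < r n)
    (hinj : Function.Injective r) (hT : ∀ n, T₁ (e n) = (r n : ℂ) • e (n + 1))
    (h : adjoint T₁ * T₂ = 1) (h' : T₂ * adjoint T₁ = 1) {θ : ℝ} {c : ℂ} (hc : ‖c‖ < 1)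
    (h₁ : IsUnit (1 - (starRingEnd ℂ c) • T₁)) (h₂ : IsUnit (1 - (starRingEnd ℂ c) • T₂))
    {f : ℤ → H} (hf : ∀ n, f n ≠ 0) (hA : ∀ n, mobius θ c T₁ (f n) = f (n + 1))
    (hAA : ∀ n, adjoint (mobius θ c T₁) (mobius θ c T₁ (f n)) = ((r n ^ 2 : ℝ) : ℂ) • f n) :
    ∃ U : H ≃ₗᵢ[ℂ] H, (∀ x, U (mobius θ c T₁ x) = T₁ (U x)) ∧
      ∀ x, U (mobius θ c T₂ x) = T₂ (U x) := by
  obtain ⟨W, hW, hW'⟩ := exists_intertwining_isometry hr hinj hT hf hA hAA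
  have hsurj := surjective_of_intertwining hr hinj hT hc h₁ hW hW'
  set U := LinearIsometryEquiv.ofSurjective W hsurj with hU
  have hUW : ∀ x, U x = W x := fun x => rfl
  refine ⟨U.symm, fun x => ?_, fun x => ?_⟩
  · rw [LinearIsometryEquiv.symm_apply_eq, hUW, ← hW, ← hUW, U.apply_symm_apply]
  · rw [LinearIsometryEquiv.symm_apply_eq, hUW]
    have h1 : ∀ y, adjoint T₁ (T₂ y) = y := fun y => congrArg (fun B : H →L[ℂ] H => B y) h
    have h2 : ∀ y, mobius θ c T₂ (adjoint (mobius θ c T₁) y) = y := fun y =>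
      congrArg (fun B : H →L[ℂ] H => B y) (adjoint_mobius_mul_mobius h h' h₁ h₂)
    conv_lhs => rw [← U.apply_symm_apply x, hUW, ← h1 (U.symm x), ← hW', h2]

section Fourier

open MeasureTheory

/-- The (unnormalised) Fourier coefficients of a function on the circle, seen as a function of the
angle. -/
def circleCoeff (g : ℝ → ℂ) (n : ℤ) : ℂ :=
  ∫ t in (0 : ℝ)..2 * Real.pi, Complex.exp (-(n * (t * Complex.I))) * g t

lemma circleCoeff_eq_fourierCoeffOn (g : ℝ → ℂ) (n : ℤ) :
    circleCoeff g n = (2 * Real.pi : ℝ) • fourierCoeffOn Real.two_pi_pos g n := by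
  rw [fourierCoeffOn_eq_integral, smul_smul, sub_zero, mul_one_div_cancel Real.two_pi_pos.ne',
    one_smul, circleCoeff]
  refine intervalIntegral.integral_congr fun t _ => ?_
  have hpi : (Real.pi : ℂ) ≠ 0 := Complex.ofReal_ne_zero.2 Real.pi_ne_zero
  simp only [fourier_coe_apply, smul_eq_mul]
  congr 2
  push_cast
  field_simp

lemma hasSum_sq_circleCoeff {g : ℝ → ℂ} (hg : Continuous g) :
    HasSum (fun n => ‖circleCoeff g n‖ ^ 2)
      (2 * Real.pi * ∫ t in (0 : ℝ)..2 * Real.pi, ‖g t‖ ^ 2) := by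
  have hL2 : MemLp g 2 (volume.restrict (Set.Ioc 0 (2 * Real.pi))) := by
    obtain ⟨C, hC⟩ := isCompact_Icc.exists_bound_of_continuousOn
      (hg.continuousOn (s := Set.Icc 0 (2 * Real.pi)))
    exact MemLp.of_bound hg.aestronglyMeasurable C
      ((ae_restrict_iff' measurableSet_Ioc).2 (ae_of_all _ fun t ht =>
        hC t (Set.Ioc_subset_Icc_self ht)))
  have h := (hasSum_sq_fourierCoeffOn Real.two_pi_pos hL2).mul_left ((2 * Real.pi) ^ 2)
  have h1 : (fun n => ‖circleCoeff g n‖ ^ 2) =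
      fun n => (2 * Real.pi) ^ 2 * ‖fourierCoeffOn Real.two_pi_pos g n‖ ^ 2 := by
    ext n
    rw [circleCoeff_eq_fourierCoeffOn, norm_smul, mul_pow, Real.norm_of_nonneg (by positivity)]
  have h2 : 2 * Real.pi * ∫ t in (0 : ℝ)..2 * Real.pi, ‖g t‖ ^ 2 =
      (2 * Real.pi) ^ 2 * ((2 * Real.pi - 0)⁻¹ • ∫ t in (0 : ℝ)..2 * Real.pi, ‖g t‖ ^ 2) := by
    have := Real.pi_ne_zero
    rw [smul_eq_mul, sub_zero]
    field_simp
  rwa [h1, h2]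

lemma exists_circleCoeff_ne_zero {g : ℝ → ℂ} (hg : Continuous g) (h0 : ∀ t, g t ≠ 0) :
    ∃ n, circleCoeff g n ≠ 0 := by
  by_contra! h
  have h1 := hasSum_sq_circleCoeff hg
  simp only [h, norm_zero, ne_eq, OfNat.ofNat_ne_zero, not_false_eq_true, zero_pow] at h1
  have h2 := h1.unique hasSum_zero
  have h3 : 0 < ∫ t in (0 : ℝ)..2 * Real.pi, ‖g t‖ ^ 2 := by
    refine intervalIntegral.intervalIntegral_pos_of_pos
      ((hg.norm.pow 2).intervalIntegrable _ _) (fun t => ?_) Real.two_pi_pos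
    have := norm_pos_iff.2 (h0 t)
    positivity
  have := Real.two_pi_pos
  exact absurd h2 (ne_of_gt (mul_pos this h3))

/-- The function `z ^ N (1 - c / z) ^ (N - 1 + a) (1 - c̄ z) ^ (- b - N - 1)` on the unit circle, in
terms of the angle. -/
def kernelFun (a b : ℝ) (c : ℂ) (N : ℤ) (t : ℝ) : ℂ :=
  Complex.exp (N * (t * Complex.I)) *
    Complex.exp ((N - 1 + a) * Complex.log (1 - c * Complex.exp (-(t * Complex.I))) -
      (b + N + 1) * Complex.log (1 - starRingEnd ℂ c * Complex.exp (t * Complex.I)))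

lemma one_sub_mem_slitPlane {w : ℂ} (hw : ‖w‖ < 1) : 1 - w ∈ Complex.slitPlane := by
  rw [sub_eq_add_neg]
  exact Complex.mem_slitPlane_of_norm_lt_one (by rwa [norm_neg])

lemma norm_exp_neg_mul_I (t : ℝ) : ‖Complex.exp (-(t * Complex.I))‖ = 1 := by
  rw [Complex.exp_neg, norm_inv, Complex.norm_exp_ofReal_mul_I, inv_one]

lemma one_sub_mul_exp_mem_slitPlane {c : ℂ} (hc : ‖c‖ < 1) (t : ℝ) :
    1 - c * Complex.exp (-(t * Complex.I)) ∈ Complex.slitPlane ∧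
      1 - starRingEnd ℂ c * Complex.exp (t * Complex.I) ∈ Complex.slitPlane := by
  constructor <;> apply one_sub_mem_slitPlane
  · rwa [norm_mul, norm_exp_neg_mul_I, mul_one]
  · rwa [norm_mul, Complex.norm_exp_ofReal_mul_I, mul_one, RCLike.norm_conj]

lemma kernelFun_ne_zero (a b : ℝ) (c : ℂ) (N : ℤ) (t : ℝ) : kernelFun a b c N t ≠ 0 :=
  mul_ne_zero (Complex.exp_ne_zero _) (Complex.exp_ne_zero _)

lemma hasDerivAt_mul_I (k : ℂ) (t : ℝ) :
    HasDerivAt (fun t : ℝ => k * (t * Complex.I)) (k * Complex.I) t := by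
  simpa using ((hasDerivAt_id t).ofReal_comp.mul_const Complex.I).const_mul k

lemma hasDerivAt_exp_mul_I (t : ℝ) :
    HasDerivAt (fun t : ℝ => Complex.exp (t * Complex.I))
      (Complex.exp (t * Complex.I) * Complex.I) t := by
  simpa using (hasDerivAt_mul_I 1 t).cexp

lemma hasDerivAt_exp_neg_mul_I (t : ℝ) :
    HasDerivAt (fun t : ℝ => Complex.exp (-(t * Complex.I)))
      (Complex.exp (-(t * Complex.I)) * -Complex.I) t := by
  simpa using (hasDerivAt_mul_I (-1) t).cexp

lemma hasDerivAt_kernelFun (a b : ℝ) {c : ℂ} (hc : ‖c‖ < 1) (N : ℤ) (t : ℝ) :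
    HasDerivAt (kernelFun a b c N)
      (kernelFun a b c N t * (Complex.I * (N +
        (N - 1 + a) * (c * Complex.exp (-(t * Complex.I)) /
          (1 - c * Complex.exp (-(t * Complex.I)))) +
        (b + N + 1) * (starRingEnd ℂ c * Complex.exp (t * Complex.I) /
          (1 - starRingEnd ℂ c * Complex.exp (t * Complex.I)))))) t := by
  obtain ⟨h1, h2⟩ := one_sub_mul_exp_mem_slitPlane hc t
  have d1 := (((hasDerivAt_exp_neg_mul_I t).const_mul c).const_sub 1).clog_real h1
  have d2 := (((hasDerivAt_exp_mul_I t).const_mul (starRingEnd ℂ c)).const_sub 1).clog_real h2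
  have := (hasDerivAt_mul_I N t).cexp.mul
    ((d1.const_mul ((N : ℂ) - 1 + a)).sub (d2.const_mul ((b : ℂ) + N + 1))).cexp
  refine this.congr_deriv ?_
  simp only [Pi.sub_apply]
  unfold kernelFun
  ring

lemma continuous_kernelFun (a b : ℝ) {c : ℂ} (hc : ‖c‖ < 1) (N : ℤ) :
    Continuous (kernelFun a b c N) :=
  continuous_iff_continuousAt.2 fun t => (hasDerivAt_kernelFun a b hc N t).continuousAt

lemma kernelFun_succ (a b : ℝ) {c : ℂ} (hc : ‖c‖ < 1) (N : ℤ) (t : ℝ) :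
    (Complex.exp (t * Complex.I) - c) * kernelFun a b c N t =
      (1 - starRingEnd ℂ c * Complex.exp (t * Complex.I)) * kernelFun a b c (N + 1) t := by
  obtain ⟨h1, h2⟩ := one_sub_mul_exp_mem_slitPlane hc t
  have h3 : kernelFun a b c (N + 1) t = kernelFun a b c N t * (Complex.exp (t * Complex.I) *
      ((1 - c * Complex.exp (-(t * Complex.I))) /
        (1 - starRingEnd ℂ c * Complex.exp (t * Complex.I)))) := by
    have e1 := Complex.exp_log (Complex.slitPlane_ne_zero h1)
    have e2 := Complex.exp_log (Complex.slitPlane_ne_zero h2)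
    rw [← e1, ← e2, ← Complex.exp_sub]
    unfold kernelFun
    rw [← Complex.exp_add, ← Complex.exp_add, ← Complex.exp_add, ← Complex.exp_add]
    congr 1
    push_cast
    ring
  have h4 : Complex.exp (t * Complex.I) * Complex.exp (-(t * Complex.I)) = 1 := by
    rw [← Complex.exp_add, add_neg_cancel, Complex.exp_zero]
  have h5 := Complex.slitPlane_ne_zero h2
  rw [h3]
  generalize 1 - starRingEnd ℂ c * Complex.exp (t * Complex.I) = d at h5 ⊢
  field_simp
  linear_combination c * kernelFun a b c N t * h4

lemma intervalIntegrable_exp_mul {g : ℝ → ℂ} (hg : Continuous g) (n : ℤ) (x y : ℝ) :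
    IntervalIntegrable (fun t : ℝ => Complex.exp (-(n * (t * Complex.I))) * g t) volume x y :=
  Continuous.intervalIntegrable (by fun_prop) _ _

lemma exp_neg_sub_one_mul (n : ℤ) (t : ℝ) :
    Complex.exp (-(((n - 1 : ℤ) : ℂ) * (t * Complex.I))) =
      Complex.exp (-(n * (t * Complex.I))) * Complex.exp (t * Complex.I) := by
  rw [← Complex.exp_add]
  push_cast
  ring_nf

lemma exp_neg_add_one_mul (n : ℤ) (t : ℝ) :
    Complex.exp (-(((n + 1 : ℤ) : ℂ) * (t * Complex.I))) =
      Complex.exp (-(n * (t * Complex.I))) * Complex.exp (-(t * Complex.I)) := by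
  rw [← Complex.exp_add]
  push_cast
  ring_nf

lemma circleCoeff_kernelFun_succ (a b : ℝ) {c : ℂ} (hc : ‖c‖ < 1) (N n : ℤ) :
    circleCoeff (kernelFun a b c N) (n - 1) - c * circleCoeff (kernelFun a b c N) n =
      circleCoeff (kernelFun a b c (N + 1)) n -
        starRingEnd ℂ c * circleCoeff (kernelFun a b c (N + 1)) (n - 1) := by
  have hi := fun k => intervalIntegrable_exp_mul (continuous_kernelFun a b hc k)
  unfold circleCoeff
  rw [← intervalIntegral.integral_const_mul, ← intervalIntegral.integral_const_mul,
    ← intervalIntegral.integral_sub (hi _ _ _ _) ((hi _ _ _ _).const_mul _),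
    ← intervalIntegral.integral_sub (hi _ _ _ _) ((hi _ _ _ _).const_mul _)]
  refine intervalIntegral.integral_congr fun t _ => ?_
  simp only [exp_neg_sub_one_mul]
  linear_combination Complex.exp (-(n * (t * Complex.I))) * kernelFun_succ a b hc N t

/-- The differential equation satisfied by `kernelFun`, in terms of Fourier coefficients. -/
lemma circleCoeff_kernelFun_recurrence (a b : ℝ) {c : ℂ} (hc : ‖c‖ < 1) (N n : ℤ) :
    c * (n + a) * circleCoeff (kernelFun a b c N) (n + 1) +
        starRingEnd ℂ c * (n + b) * circleCoeff (kernelFun a b c N) (n - 1) =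
      ((n + a) + starRingEnd ℂ c * c * (n + b) - (N + a) * (1 - starRingEnd ℂ c * c)) *
        circleCoeff (kernelFun a b c N) n := by
  set g := kernelFun a b c N with hg
  have hi := intervalIntegrable_exp_mul (continuous_kernelFun a b hc N)
  set β : ℂ := (n + a) + starRingEnd ℂ c * c * (n + b) - (N + a) * (1 - starRingEnd ℂ c * c)
    with hβ
  set W : ℝ → ℂ := fun t => Complex.exp (-n * (t * Complex.I)) *
    ((Complex.exp (-(t * Complex.I)) - starRingEnd ℂ c) * (Complex.exp (t * Complex.I) - c) * g t)
    with hW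
  have hderiv : ∀ t : ℝ, HasDerivAt W
      (Complex.I * (c * (n + a) * (Complex.exp (-(((n + 1 : ℤ) : ℂ) * (t * Complex.I))) * g t) +
        starRingEnd ℂ c * (n + b) *
          (Complex.exp (-(((n - 1 : ℤ) : ℂ) * (t * Complex.I))) * g t) -
        β * (Complex.exp (-(n * (t * Complex.I))) * g t))) t := by
    intro t
    obtain ⟨h1, h2⟩ := one_sub_mul_exp_mem_slitPlane hc t
    have h3 := Complex.slitPlane_ne_zero h1
    have h4 := Complex.slitPlane_ne_zero h2
    refine ((hasDerivAt_mul_I (-n) t).cexp.mul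
      ((((hasDerivAt_exp_neg_mul_I t).sub_const (starRingEnd ℂ c)).mul
        ((hasDerivAt_exp_mul_I t).sub_const c)).mul
          (hasDerivAt_kernelFun a b hc N t))).congr_deriv ?_
    have h4' : 1 - Complex.exp (t * Complex.I) * starRingEnd ℂ c ≠ 0 := by rwa [mul_comm]
    simp only [Pi.mul_apply]
    rw [exp_neg_sub_one_mul, exp_neg_add_one_mul, ← hg, hβ, neg_mul]
    have hz := Complex.exp_ne_zero (t * Complex.I)
    rw [Complex.exp_neg (t * Complex.I)] at h3 ⊢
    set z := Complex.exp (t * Complex.I) with hzdef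
    have h3' : z - c ≠ 0 := by
      intro h0
      apply h3
      rw [← sub_eq_zero.1 h0, mul_inv_cancel₀ hz, sub_self]
    field_simp
    ring
  have hzero := intervalIntegral.integral_eq_sub_of_hasDerivAt (fun t _ => hderiv t)
    (Continuous.intervalIntegrable (by
      have := continuous_kernelFun a b hc N
      fun_prop) 0 (2 * Real.pi))
  have hper : W (2 * Real.pi) - W 0 = 0 := by
    have h1 : Complex.exp (((2 * Real.pi : ℝ) : ℂ) * Complex.I) = 1 := by
      push_cast
      exact Complex.exp_two_pi_mul_I
    have h2 : ∀ m : ℤ, Complex.exp (m * (((2 * Real.pi : ℝ) : ℂ) * Complex.I)) = 1 := by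
      intro m
      rw [Complex.exp_int_mul, h1, one_zpow]
    have h3 : Complex.exp (-n * (((2 * Real.pi : ℝ) : ℂ) * Complex.I)) = 1 := by
      simpa using h2 (-n)
    simp only [hW, hg, kernelFun]
    rw [Complex.exp_neg (((2 * Real.pi : ℝ) : ℂ) * Complex.I), h1, h2, h3]
    simp
  rw [hper, intervalIntegral.integral_const_mul,
    intervalIntegral.integral_sub (((hi _ _ _).const_mul _).add ((hi _ _ _).const_mul _))
      ((hi _ _ _).const_mul _),
    intervalIntegral.integral_add ((hi _ _ _).const_mul _) ((hi _ _ _).const_mul _),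
    intervalIntegral.integral_const_mul, intervalIntegral.integral_const_mul,
    intervalIntegral.integral_const_mul] at hzero
  exact sub_eq_zero.1 ((mul_eq_zero.1 hzero).resolve_left Complex.I_ne_zero)

end Fourier

section Weights

lemma exists_weight_product {r : ℤ → ℝ} (hr : ∀ n, 0 < r n) :
    ∃ κ : ℤ → ℝ, κ 0 = 1 ∧ (∀ n, 0 < κ n) ∧ ∀ n, κ (n + 1) = r n * κ n := by
  let κ : ℤ → ℝ
    | Int.ofNat n => ∏ i ∈ Finset.range n, r i
    | Int.negSucc n => ∏ i ∈ Finset.range (n + 1), (r (Int.negSucc i))⁻¹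
  refine ⟨κ, Finset.prod_range_zero _, ?_, ?_⟩
  · rintro (n | n)
    · exact Finset.prod_pos fun i _ => hr _
    · exact Finset.prod_pos fun i _ => inv_pos.2 (hr _)
  · rintro (n | _ | n)
    · exact (Finset.prod_range_succ _ n).trans (mul_comm _ _)
    · change ∏ i ∈ Finset.range 0, r i =
        r (Int.negSucc 0) * ∏ i ∈ Finset.range 1, (r (Int.negSucc i))⁻¹
      rw [Finset.prod_range_zero, Finset.prod_range_one, mul_inv_cancel₀ (hr _).ne']
    · change ∏ i ∈ Finset.range (n + 1), (r (Int.negSucc i))⁻¹ =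
        r (Int.negSucc (n + 1)) * ∏ i ∈ Finset.range (n + 1 + 1), (r (Int.negSucc i))⁻¹
      rw [Finset.prod_range_succ _ (n + 1), mul_left_comm, mul_inv_cancel₀ (hr _).ne', mul_one]

lemma weight_product_le_one {r κ : ℤ → ℝ} (h0 : κ 0 = 1) (hpos : ∀ n, 0 < κ n)
    (hκ : ∀ n, κ (n + 1) = r n * κ n) (hr : ∀ n, 0 ≤ n → r n ≤ 1) (hr' : ∀ n, n < 0 → 1 ≤ r n)
    (n : ℤ) : κ n ≤ 1 := by
  induction n using Int.induction_on with
  | zero => exact h0.le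
  | succ n ih =>
    rw [hκ]
    exact (mul_le_of_le_one_left (hpos _).le (hr _ (by omega))).trans ih
  | pred n ih =>
    refine le_trans ?_ ih
    have h := hκ (-n - 1)
    rw [sub_add_cancel] at h
    rw [h]
    exact le_mul_of_one_le_left (hpos _).le (hr' _ (by omega))

lemma exists_lp_weight_mul_circleCoeff {κ : ℤ → ℝ} (hpos : ∀ n, 0 < κ n) (hκ : ∀ n, κ n ≤ 1)
    {g : ℝ → ℂ} (hg : Continuous g) : ∃ G : H, ∀ n, G n = κ n * circleCoeff g n := by
  refine ⟨⟨fun n => κ n * circleCoeff g n, memℓp_gen ?_⟩, fun _ => rfl⟩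
  simp only [ENNReal.toReal_ofNat, Real.rpow_ofNat]
  refine Summable.of_nonneg_of_le (fun n => by positivity) (fun n => ?_)
    (hasSum_sq_circleCoeff hg).summable
  rw [norm_mul, Complex.norm_real, Real.norm_of_nonneg (hpos n).le]
  exact pow_le_pow_left₀ (mul_nonneg (hpos n).le (norm_nonneg _))
    (mul_le_of_le_one_left (norm_nonneg (circleCoeff g n)) (hκ n)) 2

lemma add_div_add_pos {a b : ℝ} (ha : 0 < a) (ha1 : a < 1) (hb : 0 < b) (hb1 : b < 1) (n : ℤ) :
    0 < ((n : ℝ) + a) / (n + b) := by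
  rcases le_or_gt 0 n with h | h
  · have : (0 : ℝ) ≤ n := by exact_mod_cast h
    positivity
  · have : (n : ℝ) ≤ -1 := by exact_mod_cast Int.le_sub_one_of_lt h
    exact div_pos_of_neg_of_neg (by linarith) (by linarith)

lemma intCast_add_ne_zero {b : ℝ} (hb : 0 < b) (hb1 : b < 1) (n : ℤ) : (n : ℝ) + b ≠ 0 := by
  intro h
  have := add_div_add_pos hb hb1 hb hb1 n
  simp [h] at this

lemma abs_intCast_add_ge {b : ℝ} (hb : 0 < b) (hb1 : b < 1) (n : ℤ) :
    (|n| : ℝ) - 1 ≤ |(n : ℝ) + b| := by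
  have h := abs_add_le ((n : ℝ) + b) (-b)
  rw [add_neg_cancel_right, abs_neg, abs_of_pos hb] at h
  linarith

lemma div_add_le {a b : ℝ} (ha : 0 < a) (ha1 : a < 1) (hb : 0 < b) (hb1 : b < 1) (n : ℤ) :
    ((n : ℝ) + a) / (n + b) ≤ 1 + 1 / |(n : ℝ) + b| := by
  have hne := intCast_add_ne_zero hb hb1 n
  have h : ((n : ℝ) + a) / (n + b) = 1 + (a - b) / (n + b) := by
    field_simp
    ring
  rw [h]
  refine add_le_add le_rfl ?_
  refine (le_abs_self _).trans ?_
  rw [abs_div]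
  refine div_le_div_of_nonneg_right ?_ (abs_nonneg _)
  rw [abs_le]
  constructor <;> linarith

lemma norm_wT (a b : ℝ) (n : ℤ) : ‖wT a b n‖ = √(((n : ℝ) + a) / (n + b)) := by
  rw [wT, Complex.norm_real, Real.norm_of_nonneg (Real.sqrt_nonneg _)]

lemma norm_wT_le_of_le_abs {a b ε : ℝ} (ha : 0 < a) (ha1 : a < 1) (hb : 0 < b) (hb1 : b < 1)
    (hε : 0 < ε) {n : ℤ} (hn : 1 / ε + 1 ≤ |(n : ℝ)|) : ‖wT a b n‖ ≤ 1 + ε := by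
  rw [norm_wT]
  refine Real.sqrt_le_iff.2 ⟨by positivity, (div_add_le ha ha1 hb hb1 n).trans ?_⟩
  have h1 : 1 / ε ≤ |(n : ℝ) + b| := by linarith [abs_intCast_add_ge hb hb1 n]
  have h2 : 1 / |(n : ℝ) + b| ≤ ε := by
    rw [one_div_le (by have := one_div_pos.2 hε; linarith) hε]
    exact h1
  nlinarith

lemma exists_norm_wT_le_of_le_abs {a b : ℝ} (ha : 0 < a) (ha1 : a < 1) (hb : 0 < b) (hb1 : b < 1)
    (ε : ℝ) (hε : 0 < ε) : ∃ N : ℕ, ∀ n : ℤ, N ≤ |n| → ‖wT a b n‖ ≤ 1 + ε := by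
  obtain ⟨N, hN⟩ := exists_nat_ge (1 / ε + 1)
  refine ⟨N, fun n hn => norm_wT_le_of_le_abs ha ha1 hb hb1 hε (hN.trans ?_)⟩
  exact_mod_cast hn

lemma exists_norm_wT_le {a b : ℝ} (ha : 0 < a) (ha1 : a < 1) (hb : 0 < b) (hb1 : b < 1) :
    ∃ M, ∀ n, ‖wT a b n‖ ≤ M := by
  obtain ⟨N, hN⟩ := exists_norm_wT_le_of_le_abs ha ha1 hb hb1 1 one_pos
  refine ⟨2 + ∑ n ∈ Finset.Icc (-N : ℤ) N, ‖wT a b n‖, fun n => ?_⟩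
  by_cases h : (N : ℤ) ≤ |n|
  · have := hN n h
    have : 0 ≤ ∑ n ∈ Finset.Icc (-N : ℤ) N, ‖wT a b n‖ := by positivity
    linarith
  · have hmem : n ∈ Finset.Icc (-N : ℤ) N := Finset.mem_Icc.2 (abs_le.1 (not_le.1 h).le)
    have := Finset.single_le_sum (f := fun n => ‖wT a b n‖) (fun i _ => norm_nonneg _) hmem
    linarith

lemma isUnit_one_sub_smul_of_wT {a b : ℝ} (ha : 0 < a) (ha1 : a < 1) (hb : 0 < b) (hb1 : b < 1)
    {T : H →L[ℂ] H} (hT : ∀ n, T (e n) = wT a b n • e (n + 1)) {c : ℂ} (hc : ‖c‖ < 1) :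
    IsUnit (1 - c • T) := by
  obtain ⟨M, hM⟩ := exists_norm_wT_le ha ha1 hb hb1
  exact isUnit_one_sub_smul_shift hT hM (exists_norm_wT_le_of_le_abs ha ha1 hb hb1) hc

lemma wT_mul_wT_swap {a b : ℝ} (ha : 0 < a) (ha1 : a < 1) (hb : 0 < b) (hb1 : b < 1) (n : ℤ) :
    wT a b n * wT b a n = 1 := by
  have h1 := intCast_add_ne_zero ha ha1 n
  have h2 := intCast_add_ne_zero hb hb1 n
  rw [wT, wT, ← Complex.ofReal_mul, ← Real.sqrt_mul (add_div_add_pos ha ha1 hb hb1 n).le,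
    div_mul_div_cancel₀ h2, div_self h1, Real.sqrt_one, Complex.ofReal_one]

lemma conj_wT (a b : ℝ) (n : ℤ) : starRingEnd ℂ (wT a b n) = wT a b n := Complex.conj_ofReal _

lemma adjoint_mul_eq_one_of_wT {a b : ℝ} (ha : 0 < a) (ha1 : a < 1) (hb : 0 < b) (hb1 : b < 1)
    {T₁ T₂ : H →L[ℂ] H} (hT₁ : ∀ n, T₁ (e n) = wT a b n • e (n + 1))
    (hT₂ : ∀ n, T₂ (e n) = wT b a n • e (n + 1)) : adjoint T₁ * T₂ = 1 ∧ T₂ * adjoint T₁ = 1 := by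
  constructor <;> ext x n
  · change adjoint T₁ (T₂ x) n = x n
    rw [adjoint_shift_apply hT₁, shift_apply hT₂, conj_wT, ← mul_assoc,
      wT_mul_wT_swap ha ha1 hb hb1, one_mul]
  · change T₂ (adjoint T₁ x) n = x n
    obtain ⟨m, rfl⟩ : ∃ m, n = m + 1 := ⟨n - 1, by ring⟩
    rw [shift_apply hT₂, adjoint_shift_apply hT₁, conj_wT, ← mul_assoc,
      wT_mul_wT_swap hb hb1 ha ha1, one_mul]

lemma injective_sqrt_div {a b : ℝ} (ha : 0 < a) (hab : a < b) (hb : b < 1) :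
    Function.Injective fun n : ℤ => √(((n : ℝ) + a) / (n + b)) := by
  intro m n h
  have ha1 := hab.trans hb
  have hb0 := ha.trans hab
  have hm := intCast_add_ne_zero hb0 hb m
  have hn := intCast_add_ne_zero hb0 hb n
  have h1 := (Real.sqrt_inj (add_div_add_pos ha ha1 hb0 hb m).le
    (add_div_add_pos ha ha1 hb0 hb n).le).1 h
  rw [div_eq_div_iff hm hn] at h1
  have h2 : (b - a) * ((m : ℝ) - n) = 0 := by linear_combination h1
  have h3 := (mul_eq_zero.1 h2).resolve_left (sub_pos.2 hab).ne'
  exact_mod_cast sub_eq_zero.1 h3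

lemma sqrt_div_le_one {a b : ℝ} (ha : 0 < a) (hab : a < b) (n : ℤ) (hn : 0 ≤ n) :
    √(((n : ℝ) + a) / (n + b)) ≤ 1 := by
  have h : (0 : ℝ) ≤ n := by exact_mod_cast hn
  rw [Real.sqrt_le_one, div_le_one (by linarith)]
  linarith

lemma one_le_sqrt_div {a b : ℝ} (hab : a < b) (hb : b < 1) (n : ℤ) (hn : n < 0) :
    1 ≤ √(((n : ℝ) + a) / (n + b)) := by
  have h : (n : ℝ) ≤ -1 := by exact_mod_cast Int.le_sub_one_of_lt hn
  rw [Real.one_le_sqrt, one_le_div_of_neg (by linarith)]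
  linarith

end Weights

section Eigenvectors

variable {E : Type*} [NormedAddCommGroup E] [InnerProductSpace ℂ E] [CompleteSpace E]

lemma mobius_apply_one_sub_smul {T : E →L[ℂ] E} {c : ℂ}
    (hL : IsUnit (1 - starRingEnd ℂ c • T)) (θ : ℝ) (x : E) :
    mobius θ c T ((1 - starRingEnd ℂ c • T) x) =
      Complex.exp (θ * Complex.I) • (T x - c • x) := by
  have h : Ring.inverse (1 - starRingEnd ℂ c • T) ((1 - starRingEnd ℂ c • T) x) = x :=
    congrArg (fun S : E →L[ℂ] E => S x) (Ring.inverse_mul_cancel _ hL)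
  change Complex.exp (θ * Complex.I) • ((T - c • (1 : E →L[ℂ] E))
    (Ring.inverse (1 - starRingEnd ℂ c • T) ((1 - starRingEnd ℂ c • T) x))) = _
  rw [h]
  rfl

lemma adjoint_mobius_apply (θ : ℝ) (c : ℂ) (T : E →L[ℂ] E) (x : E) :
    adjoint (mobius θ c T) x = starRingEnd ℂ (Complex.exp (θ * Complex.I)) •
      adjoint (Ring.inverse (1 - starRingEnd ℂ c • T)) (adjoint T x - starRingEnd ℂ c • x) := by
  have h : adjoint (mobius θ c T) = starRingEnd ℂ (Complex.exp (θ * Complex.I)) •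
      (adjoint (Ring.inverse (1 - starRingEnd ℂ c • T)) *
        (adjoint T - starRingEnd ℂ c • (1 : E →L[ℂ] E))) := by
    simp only [← ContinuousLinearMap.star_eq_adjoint, mobius, star_smul, star_mul, star_sub,
      star_one, RCLike.star_def]
  rw [h]
  rfl

lemma conj_exp_mul_exp (θ : ℝ) :
    starRingEnd ℂ (Complex.exp (θ * Complex.I)) * Complex.exp (θ * Complex.I) = 1 := by
  rw [Complex.conj_mul', Complex.norm_exp_ofReal_mul_I]
  simp

lemma adjoint_mobius_mobius_apply {T : E →L[ℂ] E} {c t : ℂ}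
    (hL : IsUnit (1 - starRingEnd ℂ c • T)) (θ : ℝ) {x : E}
    (hx : adjoint T (T x - c • x) - starRingEnd ℂ c • (T x - c • x) =
      t • adjoint (1 - starRingEnd ℂ c • T) ((1 - starRingEnd ℂ c • T) x)) :
    adjoint (mobius θ c T) (mobius θ c T ((1 - starRingEnd ℂ c • T) x)) =
      t • (1 - starRingEnd ℂ c • T) x := by
  have h : ∀ y, adjoint (Ring.inverse (1 - starRingEnd ℂ c • T))
      (adjoint (1 - starRingEnd ℂ c • T) y) = y := by
    intro y
    have h1 := congrArg adjoint (Ring.mul_inverse_cancel _ hL)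
    rw [← star_eq_adjoint, ← star_eq_adjoint, star_mul, star_one] at h1
    exact congrArg (fun S : E →L[ℂ] E => S y) h1
  rw [mobius_apply_one_sub_smul hL, map_smul, adjoint_mobius_apply, hx, map_smul, h, smul_smul,
    mul_comm, conj_exp_mul_exp, one_smul]

end Eigenvectors

/-- The vectors on which the Möbius transform of `T(a, b)` acts as `T(a, b)` acts on the basis. -/
lemma exists_mobius_eigenvectors {a b : ℝ} (ha : 0 < a) (hab : a < b) (hb : b < 1)
    {T : H →L[ℂ] H} (hT : ∀ n, T (e n) = wT a b n • e (n + 1)) (θ : ℝ) {c : ℂ} (hc : ‖c‖ < 1)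
    (hL : IsUnit (1 - starRingEnd ℂ c • T)) :
    ∃ f : ℤ → H, (∀ n, f n ≠ 0) ∧ (∀ n, mobius θ c T (f n) = f (n + 1)) ∧
      ∀ n, adjoint (mobius θ c T) (mobius θ c T (f n)) =
        ((√(((n : ℝ) + a) / (n + b)) ^ 2 : ℝ) : ℂ) • f n := by
  have ha1 := hab.trans hb
  have hb0 := ha.trans hab
  obtain ⟨κ, hκ0, hκpos, hκ⟩ := exists_weight_product (r := fun n : ℤ => √(((n : ℝ) + a) / (n + b)))
    fun n => Real.sqrt_pos.2 (add_div_add_pos ha ha1 hb0 hb n)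
  have hκ1 := weight_product_le_one hκ0 hκpos hκ (sqrt_div_le_one ha hab) (one_le_sqrt_div hab hb)
  choose G hG using fun N : ℤ =>
    exists_lp_weight_mul_circleCoeff hκpos hκ1 (continuous_kernelFun a b hc N)
  have hwκ : ∀ n, wT a b n * κ n = κ (n + 1) := by
    intro n
    rw [hκ, Complex.ofReal_mul, wT]
  have hww : ∀ n, wT a b n * wT a b n = ((n : ℂ) + a) / (n + b) := by
    intro n
    rw [wT, ← Complex.ofReal_mul, Real.mul_self_sqrt (add_div_add_pos ha ha1 hb0 hb n).le]
    push_cast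
    rfl
  have hTx : ∀ (x : H) (u : ℤ → ℂ), (∀ n, x n = κ n * u n) → ∀ n, T x n = κ n * u (n - 1) := by
    intro x u hx n
    obtain ⟨m, rfl⟩ : ∃ m, n = m + 1 := ⟨n - 1, by ring⟩
    rw [shift_apply hT, hx, ← mul_assoc, hwκ, add_sub_cancel_right]
  have hAx : ∀ (x : H) (u : ℤ → ℂ), (∀ n, x n = κ n * u n) →
      ∀ n, adjoint T x n = κ n * (((n : ℂ) + a) / (n + b) * u (n + 1)) := by
    intro x u hx n
    rw [adjoint_shift_apply hT, conj_wT, hx, ← hwκ, ← hww]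
    ring
  have hsub : ∀ (S : H →L[ℂ] H) (d : ℂ) (x : H), (1 - d • S) x = x - d • S x := fun _ _ _ => rfl
  have hcoe : ∀ (x y : H) (d : ℂ) (n : ℤ), (x - d • y) n = x n - d * y n := fun _ _ _ _ => rfl
  have hcoe' : ∀ (x : H) (d : ℂ) (n : ℤ), (d • x) n = d * x n := fun _ _ _ => rfl
  have hadj : adjoint (1 - starRingEnd ℂ c • T) = 1 - c • adjoint T := by
    simp [← star_eq_adjoint]
  set u : ℤ → ℤ → ℂ := fun N => circleCoeff (kernelFun a b c N)
  have hnext : ∀ N, T (G N) - c • G N = (1 - starRingEnd ℂ c • T) (G (N + 1)) := by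
    intro N
    ext n
    rw [hsub, hcoe, hcoe, hTx _ _ (hG N), hTx _ _ (hG (N + 1)), hG, hG]
    linear_combination (κ n : ℂ) * circleCoeff_kernelFun_succ a b hc N n
  have heig : ∀ N, adjoint T (T (G N) - c • G N) - starRingEnd ℂ c • (T (G N) - c • G N) =
      (((√(((N : ℝ) + a) / (N + b)) ^ 2 : ℝ) : ℂ)) •
        adjoint (1 - starRingEnd ℂ c • T) ((1 - starRingEnd ℂ c • T) (G N)) := by
    intro N
    have hD : ∀ n, (T (G N) - c • G N) n = κ n * (u N (n - 1) - c * u N n) := by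
      intro n
      rw [hcoe, hTx _ _ (hG N), hG]
      ring
    have hLG : ∀ n, (G N - starRingEnd ℂ c • T (G N)) n =
        κ n * (u N n - starRingEnd ℂ c * u N (n - 1)) := by
      intro n
      rw [hcoe, hTx _ _ (hG N), hG]
      ring
    have hb' : ∀ n : ℤ, (n : ℂ) + b ≠ 0 := fun n => by
      exact_mod_cast intCast_add_ne_zero hb0 hb n
    ext n
    rw [hadj, hsub, hsub, Real.sq_sqrt (add_div_add_pos ha ha1 hb0 hb N).le, hcoe,
      hAx _ _ hD, hD, hcoe', hcoe, hAx _ _ hLG, hLG]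
    have hrec := circleCoeff_kernelFun_recurrence a b hc N n
    have h1 := hb' n
    have h2 := hb' N
    rw [add_sub_cancel_right]
    push_cast
    change c * (n + a) * u N (n + 1) + starRingEnd ℂ c * (n + b) * u N (n - 1) = _ * u N n at hrec
    field_simp
    linear_combination (κ n : ℂ) * ((a : ℂ) - b) * hrec
  refine ⟨fun N => Complex.exp (θ * Complex.I) ^ N • (1 - starRingEnd ℂ c • T) (G N), ?_, ?_, ?_⟩
  · intro N h0
    have h1 := (smul_eq_zero.1 h0).resolve_left (zpow_ne_zero _ (Complex.exp_ne_zero _))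
    have h2 : G N = 0 := by
      have h := congrArg (fun S : H →L[ℂ] H => S (G N)) (Ring.inverse_mul_cancel _ hL)
      change Ring.inverse (1 - starRingEnd ℂ c • T) ((1 - starRingEnd ℂ c • T) (G N)) = G N at h
      rw [← h, h1, map_zero]
    obtain ⟨n, hn⟩ := exists_circleCoeff_ne_zero (continuous_kernelFun a b hc N)
      (kernelFun_ne_zero a b c N)
    have h3 := hG N n
    rw [h2] at h3
    exact mul_ne_zero (Complex.ofReal_ne_zero.2 (hκpos n).ne') hn h3.symm
  · intro N
    rw [map_smul, mobius_apply_one_sub_smul hL, hnext, smul_smul,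
      ← zpow_add_one₀ (Complex.exp_ne_zero _)]
  · intro N
    rw [map_smul, map_smul, adjoint_mobius_mobius_apply hL θ (heig N), smul_comm]

/-- the operator `T(a, b, α)` is homogeneous. -/
theorem stmt12 (a b : ℝ) (ha : 0 < a) (hab : a < b) (hb : b < 1) (α : ℂ)
    (T₁ T₂ : H →L[ℂ] H)
    (hT₁ : ∀ n : ℤ, T₁ (e n) = wT a b n • e (n + 1))
    (hT₂ : ∀ n : ℤ, T₂ (e n) = wT b a n • e (n + 1)) :
    Homogeneous (blockOp T₁ (α • (T₁ - T₂)) T₂) := by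
  have ha1 := hab.trans hb
  have hb0 := ha.trans hab
  have h₁ : ∀ c : ℂ, ‖c‖ < 1 → IsUnit (1 - c • T₁) := fun c hc =>
    isUnit_one_sub_smul_of_wT ha ha1 hb0 hb hT₁ hc
  have h₂ : ∀ c : ℂ, ‖c‖ < 1 → IsUnit (1 - c • T₂) := fun c hc =>
    isUnit_one_sub_smul_of_wT hb0 hb ha ha1 hT₂ hc
  refine homogeneous_blockOp α h₁ h₂ fun θ c hc => ?_
  have hc' : ‖starRingEnd ℂ c‖ < 1 := by rwa [RCLike.norm_conj]
  obtain ⟨f, hf, hA, hAA⟩ := exists_mobius_eigenvectors ha hab hb hT₁ θ hc (h₁ _ hc')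
  obtain ⟨h, h'⟩ := adjoint_mul_eq_one_of_wT ha ha1 hb0 hb hT₁ hT₂
  exact exists_unitary_mobius (fun n => Real.sqrt_pos.2 (add_div_add_pos ha ha1 hb0 hb n))
    (injective_sqrt_div ha hab hb) hT₁ h h' hc (h₁ _ hc') (h₂ _ hc') hf hA hAA
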